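/- Let a and β be real numbers with 0 < a ≤ 1/2 and 1/2 < β < 1. Then liminf_{n→∞} Λ̄(n;a) ≥ −[1 + (1−2β)(1/a − 1)] / (2β(2β−1)). -/

import Mathlib

/-- Generalized binomial coefficient `C(y,j) = y(y-1)⋯(y-j+1)/j!`. -/
noncomputable def genChoose (y : ℝ) (j : ℕ) : ℝ :=
  (∏ i ∈ Finset.range j, (y - i)) / (Nat.factorial j)

/-- The Krawtchouk polynomial `K_k^{(n)}(x)`. -/
noncomputable def kraw (n k : ℕ) (x : ℝ) : ℝ :=
  ∑ j ∈ Finset.range (k + 1), (-1 : ℝ) ^ j * genChoose x j * genChoose ((n : ℝ) - x) (k - j)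

/-- The value `Λ̄(n;a)` of Fu–Wei–Yeung's dual linear program. -/
noncomputable def LambdaBar (n : ℕ) (a : ℝ) : ℝ :=
  sSup {v : ℝ | ∃ x : ℕ → ℝ,
    (∀ k ∈ Finset.Icc 1 n, 0 ≤ x k) ∧
    (∀ i ∈ Finset.Icc 2 n,
      -1 ≤ ∑ k ∈ Finset.Icc 1 n, (kraw n k 1 - kraw n k (i : ℝ)) * x k) ∧
    v = -∑ k ∈ Finset.Icc 1 n, (kraw n k 0 + kraw n k 1 * (1 / a - 1)) * x k}

open Polynomial Filter Topology in
/-- `q` has limit value `v` in degree `d`: the coefficient of `X ^ k` in `q * (1 + X) ^ (N - d)`,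
normalized by `N.choose k`, tends to `v` whenever `N → ∞` and `k / N → β`. -/
def HasCoeffLimit (β : ℝ) (d : ℕ) (q : ℝ[X]) (v : ℝ) : Prop :=
  ∀ k N : ℕ → ℕ, Tendsto N atTop atTop → Tendsto (fun n => (k n : ℝ) / N n) atTop (𝓝 β) →
    Tendsto (fun n => (q * (1 + X) ^ (N n - d)).coeff (k n) / ((N n).choose (k n) : ℝ))
      atTop (𝓝 v)

namespace HasCoeffLimit

open Polynomial Filter Topology

variable {β : ℝ} {d : ℕ} {q p : ℝ[X]} {v w : ℝ}

lemma eventually_pos_lt (hβ0 : 0 < β) (hβ1 : β < 1) {k N : ℕ → ℕ}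
    (hk : Tendsto (fun n => (k n : ℝ) / N n) atTop (𝓝 β)) :
    ∀ᶠ n in atTop, 0 < k n ∧ k n < N n := by
  filter_upwards [hk.eventually_const_lt hβ0, hk.eventually_lt_const hβ1] with n h0 h1
  have hN : (0 : ℝ) < N n := by
    rcases Nat.eq_zero_or_pos (N n) with h | h
    · simp [h] at h0
    · exact_mod_cast h
  rw [div_lt_one hN] at h1
  have h2 : (0 : ℝ) < k n := by
    rcases Nat.eq_zero_or_pos (k n) with h | h
    · simp [h] at h0
    · exact_mod_cast h
  exact ⟨by exact_mod_cast h2, by exact_mod_cast h1⟩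

lemma tendsto_pred_ratio (hβ0 : 0 < β) (hβ1 : β < 1) {k N : ℕ → ℕ} (hN : Tendsto N atTop atTop)
    (hk : Tendsto (fun n => (k n : ℝ) / N n) atTop (𝓝 β)) (e : ℕ) (he : e ≤ 1) :
    Tendsto (fun n => ((k n - e : ℕ) : ℝ) / (N n - 1 : ℕ)) atTop (𝓝 β) := by
  have hNr : Tendsto (fun n => (N n : ℝ)) atTop atTop := tendsto_natCast_atTop_atTop.comp hN
  have hinv : Tendsto (fun n => ((N n : ℝ))⁻¹) atTop (𝓝 0) := tendsto_inv_atTop_zero.comp hNr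
  have h : Tendsto (fun n => ((k n : ℝ) / N n - e * (N n : ℝ)⁻¹) / (1 - (N n : ℝ)⁻¹)) atTop
      (𝓝 ((β - e * 0) / (1 - 0))) :=
    (hk.sub (hinv.const_mul _)).div (hinv.const_sub _) (by norm_num)
  simp only [mul_zero, sub_zero, div_one] at h
  refine h.congr' ?_
  filter_upwards [eventually_pos_lt hβ0 hβ1 hk] with n hn
  rw [Nat.cast_sub (by omega), Nat.cast_sub (by omega)]
  have h1 : (0 : ℝ) < N n := by exact_mod_cast (by omega : 0 < N n)
  have h2 : (1 : ℝ) < N n := by exact_mod_cast (by omega : 1 < N n)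
  have h3 : (N n : ℝ) - 1 ≠ 0 := by linarith
  have h4 : 1 - (N n : ℝ)⁻¹ ≠ 0 := by
    rw [← one_div, one_sub_div h1.ne']
    exact div_ne_zero h3 h1.ne'
  rw [div_eq_div_iff h4 (by simpa using h3)]
  field_simp
  push_cast
  ring

lemma tendsto_pred {N : ℕ → ℕ} (hN : Tendsto N atTop atTop) :
    Tendsto (fun n => N n - 1 : ℕ → ℕ) atTop atTop :=
  (tendsto_sub_atTop_nat 1).comp hN

lemma one (hβ0 : 0 < β) (hβ1 : β < 1) : HasCoeffLimit β 0 1 1 := by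
  intro k N _ hk
  refine tendsto_const_nhds.congr' ?_
  filter_upwards [eventually_pos_lt hβ0 hβ1 hk] with n hn
  rw [one_mul, coeff_one_add_X_pow, Nat.sub_zero, div_self]
  exact_mod_cast (Nat.choose_pos hn.2.le).ne'

lemma add (hq : HasCoeffLimit β d q v) (hp : HasCoeffLimit β d p w) :
    HasCoeffLimit β d (q + p) (v + w) := by
  intro k N hN hk
  simpa only [add_mul, coeff_add, add_div] using (hq k N hN hk).add (hp k N hN hk)

lemma sub (hq : HasCoeffLimit β d q v) (hp : HasCoeffLimit β d p w) :
    HasCoeffLimit β d (q - p) (v - w) := by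
  intro k N hN hk
  simpa only [sub_mul, coeff_sub, sub_div] using (hq k N hN hk).sub (hp k N hN hk)

lemma succ (hβ0 : 0 < β) (hβ1 : β < 1) (hq : HasCoeffLimit β d q v) :
    HasCoeffLimit β (d + 1) q ((1 - β) * v) := by
  intro k N hN hk
  have h := (hk.const_sub 1).mul
    (hq k (fun n => N n - 1) (tendsto_pred hN) (tendsto_pred_ratio hβ0 hβ1 hN hk 0 zero_le_one))
  refine h.congr' ?_
  filter_upwards [eventually_pos_lt hβ0 hβ1 hk] with n hn
  obtain ⟨M, hM⟩ : ∃ M, N n = M + 1 := ⟨N n - 1, by omega⟩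
  rw [hM] at hn ⊢
  have h1 := Nat.choose_mul_succ_eq M (k n)
  have h2 : (M.choose (k n) : ℝ) * (M + 1) = (M + 1).choose (k n) * (M + 1 - k n) := by
    rw [← Nat.cast_add_one, ← Nat.cast_sub hn.2.le]
    exact_mod_cast h1
  have h3 : (M.choose (k n) : ℝ) ≠ 0 := by exact_mod_cast (Nat.choose_pos (by omega)).ne'
  have h4 : ((M + 1).choose (k n) : ℝ) ≠ 0 := by exact_mod_cast (Nat.choose_pos (by omega)).ne'
  have h5 : (M : ℝ) + 1 ≠ 0 := by positivity
  rw [show M + 1 - (d + 1) = M + 1 - 1 - d by omega, Nat.add_sub_cancel]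
  push_cast
  rw [one_sub_div h5, div_mul_div_comm, div_eq_div_iff (mul_ne_zero h5 h3) h4]
  linear_combination -((q * (1 + X) ^ (M - d)).coeff (k n)) * h2

lemma X_mul (hβ0 : 0 < β) (hβ1 : β < 1) (hq : HasCoeffLimit β d q v) :
    HasCoeffLimit β (d + 1) (X * q) (β * v) := by
  intro k N hN hk
  have h := hk.mul (hq (fun n => k n - 1) (fun n => N n - 1) (tendsto_pred hN)
    (tendsto_pred_ratio hβ0 hβ1 hN hk 1 le_rfl))
  refine h.congr' ?_
  filter_upwards [eventually_pos_lt hβ0 hβ1 hk] with n hn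
  obtain ⟨M, hM⟩ : ∃ M, N n = M + 1 := ⟨N n - 1, by omega⟩
  obtain ⟨j, hj⟩ : ∃ j, k n = j + 1 := ⟨k n - 1, by omega⟩
  rw [hM, hj] at hn ⊢
  have h2 : ((M : ℝ) + 1) * M.choose j = (M + 1).choose (j + 1) * (j + 1) := by
    exact_mod_cast Nat.add_one_mul_choose_eq M j
  have h3 : (M.choose j : ℝ) ≠ 0 := by exact_mod_cast (Nat.choose_pos (by omega)).ne'
  have h4 : ((M + 1).choose (j + 1) : ℝ) ≠ 0 := by
    exact_mod_cast (Nat.choose_pos (by omega)).ne'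
  have h5 : (M : ℝ) + 1 ≠ 0 := by positivity
  rw [show M + 1 - (d + 1) = M + 1 - 1 - d by omega, Nat.add_sub_cancel, Nat.add_sub_cancel,
    mul_assoc, coeff_X_mul]
  push_cast
  rw [div_mul_div_comm, div_eq_div_iff (mul_ne_zero h5 h3) h4]
  linear_combination -((q * (1 + X) ^ (M - d)).coeff j) * h2

lemma one_sub_X_pow (hβ0 : 0 < β) (hβ1 : β < 1) (i : ℕ) :
    HasCoeffLimit β i ((1 - X) ^ i) ((1 - 2 * β) ^ i) := by
  induction i with
  | zero => simpa using one hβ0 hβ1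
  | succ i ih =>
    convert (ih.succ hβ0 hβ1).sub (ih.X_mul hβ0 hβ1) using 1 <;> ring

lemma one_add_X_sq_pow (hβ0 : 0 < β) (hβ1 : β < 1) (i : ℕ) :
    HasCoeffLimit β (2 * i) ((1 + X ^ 2) ^ i) ((β ^ 2 + (1 - β) ^ 2) ^ i) := by
  induction i with
  | zero => simpa using one hβ0 hβ1
  | succ i ih =>
    convert ((ih.succ hβ0 hβ1).succ hβ0 hβ1).add ((ih.X_mul hβ0 hβ1).X_mul hβ0 hβ1) using 1 <;>
      ring

end HasCoeffLimit

section CoefficientDomination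

open Polynomial

/-- Every coefficient of `p` is bounded in absolute value by that of `q`. -/
def CoeffDominated (p q : ℝ[X]) : Prop := ∀ k, |p.coeff k| ≤ q.coeff k

lemma CoeffDominated.mul {p q p' q' : ℝ[X]} (h : CoeffDominated p q)
    (h' : CoeffDominated p' q') : CoeffDominated (p * p') (q * q') := by
  intro k
  rw [coeff_mul, coeff_mul]
  refine (Finset.abs_sum_le_sum_abs _ _).trans (Finset.sum_le_sum fun x _ => ?_)
  rw [abs_mul]
  exact mul_le_mul (h _) (h' _) (abs_nonneg _) ((abs_nonneg _).trans (h _))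

lemma CoeffDominated.pow {p q : ℝ[X]} (h : CoeffDominated p q) (n : ℕ) :
    CoeffDominated (p ^ n) (q ^ n) := by
  induction n with
  | zero =>
    intro k
    rw [pow_zero, pow_zero, coeff_one]
    split_ifs <;> simp
  | succ n ih =>
    rw [pow_succ, pow_succ]
    exact ih.mul h

lemma coeffDominated_one_add_X : CoeffDominated (1 + X) (1 + X) := by
  intro k
  rw [← pow_one (1 + X : ℝ[X]), coeff_one_add_X_pow, abs_of_nonneg (Nat.cast_nonneg _)]

lemma coeffDominated_one_sub_X_sq : CoeffDominated (1 - X ^ 2) (1 + X ^ 2) := by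
  intro k
  simp only [coeff_sub, coeff_add, coeff_one, coeff_X_pow]
  split_ifs <;> norm_num

lemma coeffDominated_one_sub_X_sq_sq : CoeffDominated (1 - X ^ 2) ((1 + X) ^ 2) := by
  intro k
  rw [coeff_one_add_X_pow]
  match k with
  | 0 => simp
  | 1 => simp [coeff_one, coeff_X_pow]
  | 2 => simp [coeff_one, coeff_X_pow]
  | k + 3 => simp [coeff_one, coeff_X_pow]

end CoefficientDomination

section Krawtchouk

open Polynomial Filter Topology

lemma genChoose_natCast (i j : ℕ) : genChoose (i : ℝ) j = i.choose j := by
  rw [genChoose, ← descPochhammer_eval_eq_prod_range, Nat.cast_choose_eq_descPochhammer_div]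

lemma coeff_one_sub_X_pow_real (n k : ℕ) :
    ((1 - X : ℝ[X]) ^ n).coeff k = (-1) ^ k * n.choose k := by
  have h : (1 - X : ℝ[X]) ^ n = ((1 + X) ^ n).comp (C (-1) * X) := by
    simp [sub_eq_add_neg]
  rw [h, comp_C_mul_X_coeff, coeff_one_add_X_pow, mul_comm]

/-- The generating polynomial of the Krawtchouk polynomials at `i`. -/
noncomputable def krawGen (n i : ℕ) : ℝ[X] := (1 - X) ^ i * (1 + X) ^ (n - i)

lemma kraw_natCast {n i : ℕ} (k : ℕ) (hi : i ≤ n) : kraw n k i = (krawGen n i).coeff k := by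
  rw [krawGen, coeff_mul, Finset.Nat.sum_antidiagonal_eq_sum_range_succ_mk, kraw]
  refine Finset.sum_congr rfl fun j _ => ?_
  rw [← Nat.cast_sub hi, genChoose_natCast, genChoose_natCast, coeff_one_sub_X_pow_real,
    coeff_one_add_X_pow]

lemma krawGen_zero_coeff (n k : ℕ) : (krawGen n 0).coeff k = n.choose k := by
  simp [krawGen, coeff_one_add_X_pow]

lemma krawGen_succ_coeff {n i : ℕ} (k : ℕ) (hi : i ≤ n) :
    (krawGen (n + 1) i).coeff (k + 1) = (krawGen n i).coeff (k + 1) + (krawGen n i).coeff k := by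
  have : krawGen (n + 1) i = krawGen n i + X * krawGen n i := by
    rw [krawGen, krawGen, Nat.sub_add_comm hi]
    ring
  rw [this, coeff_add, coeff_X_mul]

lemma krawGen_reflect_coeff {n i k : ℕ} (hi : i ≤ n) (hk : Even k) :
    (krawGen n (n - i)).coeff k = (krawGen n i).coeff k := by
  have h : krawGen n (n - i) = (krawGen n i).comp (C (-1) * X) := by
    simp only [krawGen, mul_comp, pow_comp, sub_comp, add_comp, one_comp, X_comp,
      Nat.sub_sub_self hi, map_neg, map_one]
    ring
  rw [h, comp_C_mul_X_coeff, hk.neg_one_pow, mul_one]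

lemma krawGen_coeff_le {n i M : ℕ} (k : ℕ) (hM : M ≤ i) (hi : 2 * i ≤ n) :
    (krawGen n i).coeff k ≤ ((1 + X ^ 2) ^ M * (1 + X) ^ (n - 2 * M) : ℝ[X]).coeff k := by
  obtain ⟨j, rfl⟩ := Nat.exists_eq_add_of_le hM
  obtain ⟨r, rfl⟩ := Nat.exists_eq_add_of_le hi
  have h1 : krawGen (2 * (M + j) + r) (M + j) =
      (1 - X ^ 2) ^ M * ((1 - X ^ 2) ^ j * (1 + X) ^ r) := by
    rw [krawGen, show 2 * (M + j) + r - (M + j) = M + j + r by omega,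
      show (1 - X ^ 2 : ℝ[X]) = (1 - X) * (1 + X) by ring, mul_pow, mul_pow]
    ring
  have h2 : (1 + X : ℝ[X]) ^ (2 * (M + j) + r - 2 * M) = ((1 + X) ^ 2) ^ j * (1 + X) ^ r := by
    rw [show 2 * (M + j) + r - 2 * M = 2 * j + r by omega, pow_add, pow_mul]
  rw [h1, h2]
  exact (le_abs_self _).trans (((coeffDominated_one_sub_X_sq.pow M).mul
    ((coeffDominated_one_sub_X_sq_sq.pow j).mul (coeffDominated_one_add_X.pow r))) k)

lemma sum_choose_mul_krawGen_coeff {n d : ℕ} (k : ℕ) (hd : d ≤ n) :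
    ∑ i ∈ Finset.range (d + 1), (d.choose i : ℝ) * (krawGen n i).coeff k =
      2 ^ d * (n - d).choose k := by
  have h : ∑ i ∈ Finset.range (d + 1), C (d.choose i : ℝ) * krawGen n i =
      C (2 ^ d) * (1 + X) ^ (n - d) := by
    have h2 : (C (2 ^ d) : ℝ[X]) = ((1 - X) + (1 + X)) ^ d := by
      rw [C_pow]; congr 1; rw [show (1 - X + (1 + X) : ℝ[X]) = 2 by ring]; rfl
    rw [h2, add_pow, Finset.sum_mul]
    refine Finset.sum_congr rfl fun i hi => ?_
    have hi : i ≤ d := Nat.lt_succ_iff.mp (Finset.mem_range.mp hi)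
    rw [krawGen, show n - i = (d - i) + (n - d) by omega, pow_add, C_eq_natCast]
    ring
  have h' := congrArg (fun p => p.coeff k) h
  simpa only [finsetSum_coeff, coeff_C_mul, coeff_one_add_X_pow] using h'

end Krawtchouk

section DualProgram

open Polynomial Filter Topology

/-- The objective values attained by feasible points of the dual linear program. -/
def dualValues (n : ℕ) (a : ℝ) : Set ℝ :=
  {v : ℝ | ∃ x : ℕ → ℝ,
    (∀ k ∈ Finset.Icc 1 n, 0 ≤ x k) ∧
    (∀ i ∈ Finset.Icc 2 n,
      -1 ≤ ∑ k ∈ Finset.Icc 1 n, (kraw n k 1 - kraw n k (i : ℝ)) * x k) ∧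
    v = -∑ k ∈ Finset.Icc 1 n, (kraw n k 0 + kraw n k 1 * (1 / a - 1)) * x k}

lemma lambdaBar_eq_sSup (n : ℕ) (a : ℝ) : LambdaBar n a = sSup (dualValues n a) := rfl

/-- The dual objective is dominated by the constraints coming from a `d`-dimensional subcube. -/
lemma neg_kraw_le_sum_subcube {n d : ℕ} {A θ : ℝ} (k : ℕ) (hd : 1 ≤ d) (hdn : d ≤ n)
    (hθ0 : 0 ≤ θ) (hθ1 : θ ≤ 1) (hA : θ * (2 ^ d - 1) = A) :
    -(kraw n k 0 + kraw n k 1 * A) ≤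
      ∑ i ∈ Finset.Icc 2 d, θ * d.choose i * (kraw n k i - kraw n k 1) := by
  have split (f : ℕ → ℝ) :
      ∑ i ∈ Finset.range (d + 1), f i = f 0 + f 1 + ∑ i ∈ Finset.Icc 2 d, f i := by
    rw [Finset.range_eq_Ico, Finset.sum_eq_sum_Ico_succ_bot (by omega),
      Finset.sum_eq_sum_Ico_succ_bot (by omega), ← add_assoc]
    rfl
  have h1 := sum_choose_mul_krawGen_coeff k hdn
  have h2 : ∑ i ∈ Finset.range (d + 1), (d.choose i : ℝ) = 2 ^ d := by
    exact_mod_cast Nat.sum_range_choose d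
  rw [split] at h1 h2
  simp only [Nat.choose_zero_right, Nat.choose_one_right, Nat.cast_one, one_mul] at h1 h2
  have h0 : kraw n k 0 = (krawGen n 0).coeff k := by
    exact_mod_cast kraw_natCast k (Nat.zero_le n)
  have h1' : kraw n k 1 = (krawGen n 1).coeff k := by
    exact_mod_cast kraw_natCast k (hd.trans hdn)
  have h3 : ∑ i ∈ Finset.Icc 2 d, θ * d.choose i * (kraw n k i - kraw n k 1) =
      θ * ∑ i ∈ Finset.Icc 2 d, d.choose i * (krawGen n i).coeff k -
        θ * (∑ i ∈ Finset.Icc 2 d, (d.choose i : ℝ)) * (krawGen n 1).coeff k := by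
    rw [mul_assoc, Finset.sum_mul, ← mul_sub, ← Finset.sum_sub_distrib, Finset.mul_sum]
    refine Finset.sum_congr rfl fun i hi => ?_
    rw [kraw_natCast k ((Finset.mem_Icc.mp hi).2.trans hdn), h1']
    ring
  rw [h3, h0, h1', eq_sub_of_add_eq' h1, eq_sub_of_add_eq' h2, ← hA]
  have h4 : 0 ≤ (1 - θ) * (krawGen n 0).coeff k := by
    rw [krawGen_zero_coeff]
    exact mul_nonneg (by linarith) (Nat.cast_nonneg _)
  have h5 : 0 ≤ θ * (2 ^ d * ((n - d).choose k : ℝ)) := by positivity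
  linarith

/-- The dual programs with fixed parameter `a` are bounded above uniformly in `n`. -/
lemma exists_dualValues_le {a : ℝ} (ha0 : 0 < a) (ha1 : a ≤ 1) :
    ∃ B : ℝ, ∀ᶠ n in atTop, ∀ v ∈ dualValues n a, v ≤ B := by
  have hA : 0 ≤ 1 / a - 1 := by
    rw [sub_nonneg, le_div_iff₀ ha0]
    linarith
  obtain ⟨e, he⟩ := pow_unbounded_of_one_lt (1 / a) (one_lt_two)
  obtain ⟨d, hd, hda⟩ : ∃ d : ℕ, 1 ≤ d ∧ 1 / a - 1 ≤ 2 ^ d - 1 :=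
    ⟨e + 1, by omega, by rw [pow_succ]; nlinarith [pow_pos (two_pos (α := ℝ)) e]⟩
  have hpos : (0 : ℝ) < 2 ^ d - 1 := by
    have : (2 : ℝ) ^ 1 ≤ 2 ^ d := pow_le_pow_right₀ one_le_two hd
    linarith
  set θ : ℝ := (1 / a - 1) / (2 ^ d - 1) with hθ
  have hθ0 : 0 ≤ θ := div_nonneg hA hpos.le
  have hθ1 : θ ≤ 1 := (div_le_one hpos).mpr hda
  have hθA : θ * (2 ^ d - 1) = 1 / a - 1 := div_mul_cancel₀ _ hpos.ne'
  refine ⟨∑ i ∈ Finset.Icc 2 d, θ * d.choose i, ?_⟩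
  filter_upwards [eventually_ge_atTop d] with n hn
  rintro v ⟨x, hx0, hx, rfl⟩
  calc -∑ k ∈ Finset.Icc 1 n, (kraw n k 0 + kraw n k 1 * (1 / a - 1)) * x k
      = ∑ k ∈ Finset.Icc 1 n, -(kraw n k 0 + kraw n k 1 * (1 / a - 1)) * x k := by
        simp only [neg_mul, Finset.sum_neg_distrib]
    _ ≤ ∑ k ∈ Finset.Icc 1 n,
          (∑ i ∈ Finset.Icc 2 d, θ * d.choose i * (kraw n k i - kraw n k 1)) * x k :=
        Finset.sum_le_sum fun k hk => mul_le_mul_of_nonneg_right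
          (neg_kraw_le_sum_subcube k hd hn hθ0 hθ1 hθA) (hx0 k hk)
    _ = ∑ i ∈ Finset.Icc 2 d, θ * d.choose i *
          -∑ k ∈ Finset.Icc 1 n, (kraw n k 1 - kraw n k i) * x k := by
        simp only [Finset.sum_mul, Finset.mul_sum, ← Finset.sum_neg_distrib]
        rw [Finset.sum_comm]
        refine Finset.sum_congr rfl fun i _ => Finset.sum_congr rfl fun k _ => ?_
        ring
    _ ≤ ∑ i ∈ Finset.Icc 2 d, θ * d.choose i := by
        refine Finset.sum_le_sum fun i hi => ?_
        have h := hx i (Finset.mem_Icc.mpr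
          ⟨(Finset.mem_Icc.mp hi).1, (Finset.mem_Icc.mp hi).2.trans hn⟩)
        exact mul_le_of_le_one_right (by positivity) (by linarith)

/-- Putting equal weight on `k` and `k + 1` in length `n` gives Krawtchouk values in length
`n + 1`. -/
lemma mem_dualValues_of_two_point {n k : ℕ} {a c t : ℝ} (hk : 1 ≤ k) (hkn : k + 1 ≤ n)
    (hc : 0 ≤ c)
    (ht : (krawGen (n + 1) 1).coeff (k + 1) / ((n + 1).choose (k + 1) : ℝ) = t)
    (h : ∀ i, 2 ≤ i → i ≤ n →
      -1 ≤ c * (t - (krawGen (n + 1) i).coeff (k + 1) / ((n + 1).choose (k + 1) : ℝ))) :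
    -(c * (1 + t * (1 / a - 1))) ∈ dualValues n a := by
  have hC : (0 : ℝ) < (n + 1).choose (k + 1) := by
    exact_mod_cast Nat.choose_pos (by omega)
  set x : ℕ → ℝ := fun j => if j = k ∨ j = k + 1 then c / (n + 1).choose (k + 1) else 0 with hx
  have hsum (f : ℕ → ℝ) : ∑ j ∈ Finset.Icc 1 n, f j * x j =
      (f (k + 1) + f k) * (c / (n + 1).choose (k + 1)) := by
    have hsub : ({k, k + 1} : Finset ℕ) ⊆ Finset.Icc 1 n := by
      intro j hj
      simp only [Finset.mem_insert, Finset.mem_singleton] at hj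
      rw [Finset.mem_Icc]
      omega
    rw [← Finset.sum_subset hsub, Finset.sum_pair (by omega)]
    · simp only [hx, true_or, or_true, if_true]
      ring
    · intro j _ hj
      simp only [Finset.mem_insert, Finset.mem_singleton] at hj
      simp only [hx, if_neg hj, mul_zero]
  have hpair (i : ℕ) (hi : i ≤ n) :
      kraw n (k + 1) i + kraw n k i = (krawGen (n + 1) i).coeff (k + 1) := by
    rw [kraw_natCast _ hi, kraw_natCast _ hi, krawGen_succ_coeff k hi]
  have hpair0 : kraw n (k + 1) 0 + kraw n k 0 = (n + 1).choose (k + 1) := by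
    rw [← krawGen_zero_coeff]
    exact_mod_cast hpair 0 (Nat.zero_le n)
  have hpair1 : kraw n (k + 1) 1 + kraw n k 1 = t * (n + 1).choose (k + 1) := by
    rw [← ht, div_mul_cancel₀ _ hC.ne']
    exact_mod_cast hpair 1 (by omega)
  refine ⟨x, fun j _ => ?_, fun i hi => ?_, ?_⟩
  · simp only [hx]
    split_ifs
    · positivity
    · exact le_rfl
  · rw [Finset.mem_Icc] at hi
    rw [hsum]
    refine (h i hi.1 hi.2).trans_eq ?_
    rw [← hpair i hi.2]
    field_simp
    linear_combination (-c) * hpair1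
  · rw [hsum]
    field_simp
    linear_combination c * hpair0 + c * (1 / a - 1) * hpair1

end DualProgram

section Asymptotics

open Polynomial Filter Topology

/-- An even degree of size asymptotically `β * (n + 1)`. -/
noncomputable def evenDegree (β : ℝ) (n : ℕ) : ℕ := 2 * ⌊β / 2 * ((n + 1 : ℕ) : ℝ)⌋₊

lemma even_evenDegree (β : ℝ) (n : ℕ) : Even (evenDegree β n) := even_two_mul _

lemma tendsto_evenDegree_div {β : ℝ} (hβ : 0 < β) :
    Tendsto (fun n => (evenDegree β n : ℝ) / (n + 1 : ℕ)) atTop (𝓝 β) := by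
  have h := ((tendsto_nat_floor_mul_div_atTop (R := ℝ) (by positivity : 0 ≤ β / 2)).comp
    (tendsto_natCast_atTop_atTop.comp (tendsto_add_atTop_nat 1))).const_mul 2
  rw [mul_div_cancel₀ β two_ne_zero] at h
  refine h.congr fun n => ?_
  simp only [Function.comp_apply, evenDegree, Nat.cast_mul, Nat.cast_ofNat, mul_div_assoc]

lemma tendsto_krawGen_evenDegree {β : ℝ} (hβ0 : 0 < β) (hβ1 : β < 1) (i : ℕ) :
    Tendsto (fun n => (krawGen (n + 1) i).coeff (evenDegree β n) /
      ((n + 1).choose (evenDegree β n) : ℝ)) atTop (𝓝 ((1 - 2 * β) ^ i)) :=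
  HasCoeffLimit.one_sub_X_pow hβ0 hβ1 i _ _ (tendsto_add_atTop_nat 1)
    (tendsto_evenDegree_div hβ0)

/-- At even degrees the normalized Krawtchouk values are uniformly at most
`(1 - 2 * β) ^ 2 + ε`. -/
lemma eventually_krawGen_evenDegree_le {β ε : ℝ} (hβ : 1 / 2 < β) (hβ1 : β < 1) (hε : 0 < ε) :
    ∀ᶠ n in atTop, ∀ i, 1 ≤ i → i ≤ n → (krawGen (n + 1) i).coeff (evenDegree β n) /
      ((n + 1).choose (evenDegree β n) : ℝ) ≤ (1 - 2 * β) ^ 2 + ε := by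
  have hβ0 : 0 < β := by linarith
  have ht : 0 < (1 - 2 * β) ^ 2 := by nlinarith
  obtain ⟨M, hM⟩ := exists_pow_lt_of_lt_one ht
    (by nlinarith : β ^ 2 + (1 - β) ^ 2 < 1)
  have hbig := (HasCoeffLimit.one_add_X_sq_pow hβ0 hβ1 M _ _ (tendsto_add_atTop_nat 1)
    (tendsto_evenDegree_div hβ0)).eventually_lt_const hM
  have hpow (i : ℕ) (hi : 1 ≤ i) : (1 - 2 * β) ^ i ≤ (1 - 2 * β) ^ 2 := by
    rcases hi.eq_or_lt with rfl | hi
    · nlinarith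
    · refine (le_abs_self _).trans ?_
      rw [abs_pow, ← sq_abs (1 - 2 * β)]
      exact pow_le_pow_of_le_one (abs_nonneg _) (abs_le.mpr ⟨by linarith, by linarith⟩) hi
  have hsmall : ∀ᶠ n in atTop, ∀ i ∈ Finset.Ico 1 M,
      (krawGen (n + 1) i).coeff (evenDegree β n) /
        ((n + 1).choose (evenDegree β n) : ℝ) < (1 - 2 * β) ^ 2 + ε := by
    rw [Finset.eventually_all]
    intro i hi
    refine (tendsto_krawGen_evenDegree hβ0 hβ1 i).eventually_lt_const ?_
    linarith [hpow i (Finset.mem_Ico.mp hi).1]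
  filter_upwards [hbig, hsmall] with n hb hs
  have half (i : ℕ) (hi1 : 1 ≤ i) (hi : 2 * i ≤ n + 1) :
      (krawGen (n + 1) i).coeff (evenDegree β n) /
        ((n + 1).choose (evenDegree β n) : ℝ) ≤ (1 - 2 * β) ^ 2 + ε := by
    rcases lt_or_ge i M with h | h
    · exact (hs i (Finset.mem_Ico.mpr ⟨hi1, h⟩)).le
    · refine (div_le_div_of_nonneg_right (krawGen_coeff_le _ h hi) (Nat.cast_nonneg _)).trans ?_
      linarith
  intro i hi1 hin
  rcases le_or_gt (2 * i) (n + 1) with h | h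
  · exact half i hi1 h
  · rw [← krawGen_reflect_coeff (by omega) (even_evenDegree β n)]
    exact half _ (by omega) (by omega)

lemma eventually_exists_mem_dualValues {a β c b : ℝ} (hβ : 1 / 2 < β) (hβ1 : β < 1)
    (hc0 : 0 < c) (hc : c * (2 * β * (2 * β - 1)) < 1)
    (hb : b < -(c * (1 + (1 - 2 * β) * (1 / a - 1)))) :
    ∀ᶠ n in atTop, ∃ v ∈ dualValues n a, b ≤ v := by
  have hβ0 : 0 < β := by linarith
  obtain ⟨ε, hε0, hε⟩ : ∃ ε : ℝ, 0 < ε ∧ c * (2 * β * (2 * β - 1) + 2 * ε) ≤ 1 := by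
    refine ⟨(1 - c * (2 * β * (2 * β - 1))) / (2 * c), by
      apply div_pos <;> linarith, le_of_eq ?_⟩
    field_simp
    ring
  have ht := tendsto_krawGen_evenDegree hβ0 hβ1 1
  rw [pow_one] at ht
  have hobj := (((ht.mul_const (1 / a - 1)).const_add 1).const_mul c).neg.eventually_const_lt hb
  have hdeg : ∀ᶠ n in atTop, 0 < evenDegree β n ∧ evenDegree β n < n + 1 :=
    HasCoeffLimit.eventually_pos_lt hβ0 hβ1 (tendsto_evenDegree_div hβ0)
  filter_upwards [hobj, hdeg, eventually_krawGen_evenDegree_le hβ hβ1 hε0,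
    ht.eventually_const_lt (sub_lt_self _ hε0)] with n hn hk hle htn
  obtain ⟨k, hk1, hkd⟩ : ∃ k, 1 ≤ k ∧ evenDegree β n = k + 1 := by
    refine ⟨evenDegree β n - 1, ?_, by omega⟩
    obtain ⟨r, hr⟩ := even_evenDegree β n
    omega
  rw [hkd] at hn hk hle htn
  refine ⟨_, mem_dualValues_of_two_point hk1 (by omega) hc0.le rfl fun i hi2 hin => ?_, hn.le⟩
  have h1 := hle i (by omega) hin
  have h2 : -(2 * β * (2 * β - 1) + 2 * ε) ≤
      (krawGen (n + 1) 1).coeff (k + 1) / ((n + 1).choose (k + 1) : ℝ) -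
        (krawGen (n + 1) i).coeff (k + 1) / ((n + 1).choose (k + 1) : ℝ) := by
    linarith
  have h3 := mul_le_mul_of_nonneg_left h2 hc0.le
  linarith

end Asymptotics

theorem lambdaBar_liminf_ge (a β : ℝ) (ha0 : 0 < a) (ha : a ≤ 1 / 2)
    (hβ : 1 / 2 < β) (hβ1 : β < 1) :
    -(1 + (1 - 2 * β) * (1 / a - 1)) / (2 * β * (2 * β - 1)) ≤
      Filter.liminf (fun n : ℕ => LambdaBar n a) Filter.atTop := by
  obtain ⟨B, hB⟩ := exists_dualValues_le ha0 (by linarith)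
  have hD : 0 < 2 * β * (2 * β - 1) := by
    apply mul_pos <;> linarith
  have hlow {b : ℝ} (hb : b < -(1 + (1 - 2 * β) * (1 / a - 1)) / (2 * β * (2 * β - 1))) :
      ∀ᶠ n in Filter.atTop, ∃ v ∈ dualValues n a, b ≤ v := by
    have hcont : Filter.Tendsto (fun c : ℝ => -(c * (1 + (1 - 2 * β) * (1 / a - 1))))
        (nhdsWithin (2 * β * (2 * β - 1))⁻¹ (Set.Iio (2 * β * (2 * β - 1))⁻¹))
        (nhds (-((2 * β * (2 * β - 1))⁻¹ * (1 + (1 - 2 * β) * (1 / a - 1))))) :=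
      (Continuous.tendsto (by fun_prop) _).mono_left nhdsWithin_le_nhds
    rw [neg_div, div_eq_inv_mul] at hb
    obtain ⟨c, hbc, hc0, hc⟩ := ((hcont.eventually_const_lt hb).and
      (Ioo_mem_nhdsLT (inv_pos.mpr hD))).exists
    refine eventually_exists_mem_dualValues hβ hβ1 hc0 ?_ hbc
    rwa [← lt_inv_mul_iff₀' hD, mul_one]
  have hle : ∀ᶠ n in Filter.atTop, LambdaBar n a ≤ B := by
    filter_upwards [hB, hlow (sub_one_lt _)] with n hn ⟨v, hv, _⟩
    exact csSup_le ⟨v, hv⟩ hn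
  refine le_of_forall_lt_imp_le_of_dense fun b hb => Filter.le_liminf_of_le
    (Filter.IsCoboundedUnder.of_frequently_le hle.frequently) ?_
  filter_upwards [hB, hlow hb] with n hn ⟨v, hv, hbv⟩
  exact hbv.trans (le_csSup ⟨B, hn⟩ hv)
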